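/- Let v ∈ W^P and let α ∈ Φ⁺ be a positive root such that s_α v ∈ W^P and ℓ(s_α v) = ℓ(v) − 1. Then α is a simple root. -/

import Mathlib

open scoped RealInnerProductSpace
open Classical

noncomputable section

variable (V : Type) [NormedAddCommGroup V] [InnerProductSpace ℝ V]

/-- The reflection determined by a vector `α` (the identity map if `α = 0`),
as a linear endomorphism:  `x ↦ x - (2⟪x,α⟫/⟪α,α⟫) • α`. -/
def reflMap (α : V) : V →ₗ[ℝ] V where
  toFun x := x - (2 * ⟪x, α⟫ / ⟪α, α⟫) • α
  map_add' x y := by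
    simp only [inner_add_left]
    rw [show 2 * (⟪x, α⟫ + ⟪y, α⟫) / ⟪α, α⟫
        = 2 * ⟪x, α⟫ / ⟪α, α⟫ + 2 * ⟪y, α⟫ / ⟪α, α⟫ by ring, add_smul]
    abel
  map_smul' c x := by
    simp only [real_inner_smul_left, RingHom.id_apply, smul_sub]
    rw [show 2 * (c * ⟪x, α⟫) / ⟪α, α⟫ = c * (2 * ⟪x, α⟫ / ⟪α, α⟫) by ring,
      mul_smul]

lemma reflMap_apply (α x : V) :
    reflMap V α x = x - (2 * ⟪x, α⟫ / ⟪α, α⟫) • α := rfl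

lemma reflMap_involutive (α : V) : ∀ x, reflMap V α (reflMap V α x) = x := by
  intro x
  by_cases h : (⟪α, α⟫ : ℝ) = 0
  · have h0 : α = 0 := inner_self_eq_zero.mp h
    simp [reflMap_apply, h0]
  · rw [reflMap_apply, reflMap_apply, inner_sub_left, real_inner_smul_left,
      div_mul_cancel₀ _ h]
    rw [show ⟪x, α⟫ - 2 * ⟪x, α⟫ = -⟪x, α⟫ by ring]
    rw [show 2 * -⟪x, α⟫ / ⟪α, α⟫ = -(2 * ⟪x, α⟫ / ⟪α, α⟫) by ring, neg_smul]
    abel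

/-- The reflection determined by a vector `α`, as a linear automorphism of `V`. -/
def sref (α : V) : V ≃ₗ[ℝ] V :=
  { reflMap V α with
    invFun := reflMap V α
    left_inv := reflMap_involutive V α
    right_inv := reflMap_involutive V α }

lemma sref_apply (α x : V) :
    sref V α x = x - (2 * ⟪x, α⟫ / ⟪α, α⟫) • α := rfl

variable {V}

/-- The coroot `α^∨ = 2α/⟪α,α⟫` associated with a root `α`, under the identification of the
coweight space with `V` given by the inner product. -/
def coroot (α : V) : V := (2 / ⟪α, α⟫) • α

/-- The dimension of the `(-1)`-eigenspace of a linear automorphism. -/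
def lamEig (σ : V ≃ₗ[ℝ] V) : ℕ :=
  Module.finrank ℝ (Module.End.eigenspace (σ : V →ₗ[ℝ] V) (-1))

/-- The action `s_α ∘ σ` of a simple reflection on an involution: `s_α σ` if `s_α` and `σ`
commute, and `s_α σ s_α` otherwise. -/
def circAct (α : V) (σ : V ≃ₗ[ℝ] V) : V ≃ₗ[ℝ] V :=
  if sref V α * σ = σ * sref V α then sref V α * σ else sref V α * σ * sref V α

/-- A set of pairwise orthogonal vectors. -/
def OrthSet (S : Finset V) : Prop :=
  (↑S : Set V).Pairwise fun a b => ⟪a, b⟫ = 0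

/-- The product `σ_S` of the (commuting) reflections in the elements of an orthogonal set
`S`. -/
def sigmaOf (S : Finset V) : V ≃ₗ[ℝ] V :=
  (S.toList.map (sref V)).prod

variable (V)

/-- A finite crystallographic reduced root system in the Euclidean space `V`,
together with a fixed choice of simple roots. -/
structure RSD where
  /-- The set of roots. -/
  Φ : Finset V
  /-- The set of simple roots. -/
  Δ : Finset V
  nonzero : (0 : V) ∉ Φ
  span_top : Submodule.span ℝ (Φ : Set V) = ⊤
  reduced : ∀ α ∈ Φ, ∀ c : ℝ, c • α ∈ Φ → c = 1 ∨ c = -1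
  crystal : ∀ α ∈ Φ, ∀ β ∈ Φ, ∃ n : ℤ, (n : ℝ) = 2 * ⟪β, α⟫ / ⟪α, α⟫
  reflClosed : ∀ α ∈ Φ, ∀ β ∈ Φ, sref V α β ∈ Φ
  Δ_sub : Δ ⊆ Φ
  Δ_indep : LinearIndependent ℝ (fun x : (Δ : Set V) => (x : V))
  Δ_base : ∀ α ∈ Φ, (∃ c : V → ℕ, α = ∑ γ ∈ Δ, (c γ : ℝ) • γ) ∨
      (∃ c : V → ℕ, -α = ∑ γ ∈ Δ, (c γ : ℝ) • γ)

namespace RSD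

variable {V}
variable (D : RSD V)

/-- The set of positive roots. -/
def Pos : Set V :=
  {α | α ∈ D.Φ ∧ ∃ c : V → ℕ, α = ∑ γ ∈ D.Δ, (c γ : ℝ) • γ}

/-- The set of negative roots. -/
def Neg : Set V := {α | -α ∈ D.Pos}

/-- The Weyl group, as the subgroup of `GL(V)` generated by the simple reflections. -/
def W : Subgroup (V ≃ₗ[ℝ] V) := Subgroup.closure ((fun γ => sref V γ) '' ↑D.Δ)

/-- The length of `w`: the least number of simple reflections needed to write `w` as a
product of simple reflections. -/
def length (w : V ≃ₗ[ℝ] V) : ℕ :=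
  sInf {n | ∃ l : List V, l.length = n ∧ (∀ γ ∈ l, γ ∈ D.Δ) ∧ w = (l.map (sref V)).prod}

/-- The Bruhat order on the Weyl group: `u ≤ v` iff `v` is obtained from `u` by successively
multiplying by reflections, each time increasing the length. -/
def ble (u v : V ≃ₗ[ℝ] V) : Prop :=
  Relation.ReflTransGen
    (fun x y => (∃ β ∈ D.Φ, y = sref V β * x) ∧ D.length x < D.length y) u v

/-- The strict Bruhat order. -/
def blt (u v : V ≃ₗ[ℝ] V) : Prop := D.ble u v ∧ u ≠ v

/-- The dominance order: `y - x` is a nonnegative integer combination of simple roots. -/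
def dom (x y : V) : Prop := ∃ c : V → ℕ, y - x = ∑ γ ∈ D.Δ, (c γ : ℝ) • γ

/-- The dominance order on coweights: `y - x` is a nonnegative integer combination of simple
coroots. -/
def cdom (x y : V) : Prop := ∃ c : V → ℕ, y - x = ∑ γ ∈ D.Δ, (c γ : ℝ) • coroot γ

/-- The length `L(σ) = (ℓ(σ) + λ(σ))/2` of an involution `σ`, where `λ(σ)` is the dimension
of the `(-1)`-eigenspace of `σ`. -/
def Linv (σ : V ≃ₗ[ℝ] V) : ℚ :=
  ((D.length σ : ℚ) + (lamEig σ : ℚ)) / 2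

end RSD

/-- A finite irreducible crystallographic reduced root system, with a fixed choice of simple
roots and a marked simple root `αP` whose coefficient in the highest root `θ` equals `1`
(the cominuscule case). -/
structure MRSD extends RSD V where
  irred : ¬ ∃ A B : Set V, A.Nonempty ∧ B.Nonempty ∧ A ∪ B = ↑Φ ∧
      ∀ α ∈ A, ∀ β ∈ B, ⟪α, β⟫ = 0
  /-- The marked simple root. -/
  αP : V
  αP_mem : αP ∈ Δ
  /-- The highest root. -/
  θ : V
  θ_mem : θ ∈ Φ
  θ_high : ∀ α ∈ Φ, ∃ c : V → ℕ, θ - α = ∑ γ ∈ Δ, (c γ : ℝ) • γ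
  θ_coeff : ∃ c : V → ℕ, (θ = ∑ γ ∈ Δ, (c γ : ℝ) • γ) ∧ c αP = 1

namespace MRSD

variable {V}
variable (M : MRSD V)

/-- The set `Ψ` of positive roots in which the marked simple root `αP` has coefficient `1`. -/
def Psi : Set V :=
  {α | α ∈ M.Φ ∧ ∃ c : V → ℕ, (α = ∑ γ ∈ M.Δ, (c γ : ℝ) • γ) ∧ c M.αP = 1}

/-- The set of positive roots of the subsystem `Φ_P`, i.e. the positive roots in which the
marked simple root `αP` has coefficient `0`. -/
def PosP : Set V :=
  {α | α ∈ M.Φ ∧ ∃ c : V → ℕ, (α = ∑ γ ∈ M.Δ, (c γ : ℝ) • γ) ∧ c M.αP = 0}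

/-- The parabolic subgroup `W_P` generated by the simple reflections in `Δ ∖ {αP}`. -/
def WP : Subgroup (V ≃ₗ[ℝ] V) :=
  Subgroup.closure ((fun γ => sref V γ) '' ↑(M.Δ.erase M.αP))

/-- The inversion set `Φ⁺(v) = {α ∈ Φ⁺ : v(α) ∈ Φ⁻}`. -/
def InvSet (v : V ≃ₗ[ℝ] V) : Set V := {α | α ∈ M.Pos ∧ v α ∈ M.Neg}

/-- `v` belongs to `W^P`: it lies in `W` and has minimal length in its coset `v W_P`. -/
def IsMinRep (v : V ≃ₗ[ℝ] V) : Prop :=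
  v ∈ M.W ∧ ∀ u, u ∈ M.W → v⁻¹ * u ∈ M.WP → M.length v ≤ M.length u

/-- `μ` is the minimal length representative `[w]^P` of the coset `w W_P`. -/
def IsMinRepOf (μ w : V ≃ₗ[ℝ] V) : Prop :=
  (μ ∈ M.W ∧ w⁻¹ * μ ∈ M.WP) ∧
    ∀ u, u ∈ M.W → w⁻¹ * u ∈ M.WP → M.length μ ≤ M.length u

/-- The subset `Φ_S = {α ∈ Φ : σ_S(α) = -α}` determined by an orthogonal set of roots `S`. -/
def PhiSet (S : Finset V) : Set V := {α | α ∈ M.Φ ∧ sigmaOf S α = -α}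

/-- A root is long if its squared length is maximal among the roots. -/
def IsLong (α : V) : Prop := ∀ β ∈ M.Φ, ⟪β, β⟫ ≤ ⟪α, α⟫

/-- Admissible pair: `v ∈ W^P`, `S ⊆ Ψ` a set of pairwise orthogonal roots with
`v(S) ⊆ Φ⁻`. -/
def Admissible (v : V ≃ₗ[ℝ] V) (S : Finset V) : Prop :=
  M.IsMinRep v ∧ (↑S : Set V) ⊆ M.Psi ∧ OrthSet S ∧ ∀ β ∈ S, v β ∈ M.Neg

/-- The length `L(v,S) = (ℓ(σ_{v(S)}) + |S|)/2` of an admissible pair `(v,S)`. -/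
def pairL (v : V ≃ₗ[ℝ] V) (S : Finset V) : ℚ :=
  ((M.length (sigmaOf (S.image fun x => v x)) : ℚ) + (S.card : ℚ)) / 2

end MRSD

namespace RSD

variable {V} (D : RSD V)

lemma ne_zero_of_mem {α : V} (h : α ∈ D.Φ) : α ≠ 0 := fun h0 => D.nonzero (h0 ▸ h)

lemma sref_self {α : V} (h : α ≠ 0) : sref V α α = -α := by
  rw [sref_apply, mul_div_assoc, div_self (inner_self_ne_zero.mpr h), mul_one, two_smul]
  abel

lemma sref_mul_self (α : V) : sref V α * sref V α = 1 :=
  LinearEquiv.ext (reflMap_involutive V α)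

lemma sref_sref (α x : V) : sref V α (sref V α x) = x := reflMap_involutive V α x

lemma sref_inv (α : V) : (sref V α)⁻¹ = sref V α :=
  inv_eq_of_mul_eq_one_right (sref_mul_self α)

lemma neg_mem {α : V} (h : α ∈ D.Φ) : -α ∈ D.Φ := by
  simpa only [sref_self (D.ne_zero_of_mem h)] using D.reflClosed α h α h

lemma inner_sref (α x y : V) : ⟪sref V α x, sref V α y⟫ = ⟪x, y⟫ := by
  by_cases h : α = 0
  · simp [sref_apply, h]
  · have h' : ⟪α, α⟫ ≠ 0 := inner_self_ne_zero.mpr h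
    simp only [sref_apply, inner_sub_left, inner_sub_right, real_inner_smul_left,
      real_inner_smul_right, real_inner_comm y α]
    field_simp
    ring

/-- An isometry conjugates the reflection in `γ` to the reflection in its image. -/
lemma mul_sref_eq {w : V ≃ₗ[ℝ] V} (hw : ∀ x y, ⟪w x, w y⟫ = ⟪x, y⟫) (γ : V) :
    w * sref V γ = sref V (w γ) * w := by
  ext x
  simp only [LinearEquiv.mul_apply, sref_apply, map_sub, map_smul, hw]

/-! ### Coordinates with respect to the simple roots -/

/-- The simple roots as a basis. -/
def simpleBasis : Module.Basis (D.Δ : Set V) ℝ V :=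
  Module.Basis.mk D.Δ_indep (by
    rw [← D.span_top, Submodule.span_le, Subtype.range_coe]
    have key : ∀ c : V → ℕ, ∑ γ ∈ D.Δ, (c γ : ℝ) • γ ∈ Submodule.span ℝ (D.Δ : Set V) :=
      fun c => Submodule.sum_mem _ fun γ hγ =>
        Submodule.smul_mem _ _ (Submodule.subset_span hγ)
    intro α hα
    rcases D.Δ_base α hα with ⟨c, hc⟩ | ⟨c, hc⟩
    · rw [hc]; exact key c
    · rw [← neg_neg α, hc]; exact Submodule.neg_mem _ (key c))

/-- The coefficient of a simple root in a vector. -/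
def coeff (γ : (D.Δ : Set V)) : V →ₗ[ℝ] ℝ := D.simpleBasis.coord γ

lemma coeff_simple (γ δ : (D.Δ : Set V)) : D.coeff γ δ = if δ = γ then 1 else 0 := by
  have h : D.simpleBasis δ = (δ : V) := by simp [simpleBasis]
  rw [coeff, ← h, Module.Basis.coord_apply, Module.Basis.repr_self, Finsupp.single_apply]

lemma coeff_sum (γ : (D.Δ : Set V)) (c : V → ℕ) :
    D.coeff γ (∑ δ ∈ D.Δ, (c δ : ℝ) • δ) = c γ := by
  rw [map_sum, Finset.sum_eq_single (γ : V)]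
  · simp [D.coeff_simple γ γ]
  · intro δ hδ hne
    have := D.coeff_simple γ ⟨δ, hδ⟩
    rw [if_neg (fun h => hne (congrArg Subtype.val h))] at this
    rw [map_smul, this, smul_zero]
  · exact fun h => absurd γ.2 h

lemma eq_of_coeff_eq {x y : V} (h : ∀ γ, D.coeff γ x = D.coeff γ y) : x = y :=
  D.simpleBasis.ext_elem h

lemma coeff_nonneg {x : V} (hx : x ∈ D.Pos) (γ) : 0 ≤ D.coeff γ x := by
  obtain ⟨_, c, rfl⟩ := hx
  rw [coeff_sum]
  positivity

lemma pos_or_neg {x : V} (hx : x ∈ D.Φ) : x ∈ D.Pos ∨ x ∈ D.Neg :=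
  (D.Δ_base x hx).imp (fun h => ⟨hx, h⟩) fun h => ⟨D.neg_mem hx, h⟩

lemma coeff_nonpos {x : V} (hx : x ∈ D.Neg) (γ) : D.coeff γ x ≤ 0 := by
  have := D.coeff_nonneg hx γ
  rw [map_neg] at this
  linarith

lemma not_neg_of_pos {x : V} (hx : x ∈ D.Pos) : x ∉ D.Neg := fun h =>
  D.ne_zero_of_mem hx.1 <| D.eq_of_coeff_eq fun γ => by
    rw [map_zero]
    exact le_antisymm (D.coeff_nonpos h γ) (D.coeff_nonneg hx γ)

lemma neg_of_not_pos {x : V} (hx : x ∈ D.Φ) (h : x ∉ D.Pos) : x ∈ D.Neg :=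
  (D.pos_or_neg hx).resolve_left h

lemma pos_of_not_neg {x : V} (hx : x ∈ D.Φ) (h : x ∉ D.Neg) : x ∈ D.Pos :=
  (D.pos_or_neg hx).resolve_right h

lemma neg_neg_of_pos {x : V} (hx : x ∈ D.Pos) : -x ∈ D.Neg := by
  simpa [Neg] using hx

lemma pos_of_coeff_pos {x : V} (hx : x ∈ D.Φ) {γ} (h : 0 < D.coeff γ x) : x ∈ D.Pos :=
  D.pos_of_not_neg hx fun hn => h.not_ge (D.coeff_nonpos hn γ)

lemma neg_of_coeff_neg {x : V} (hx : x ∈ D.Φ) {γ} (h : D.coeff γ x < 0) : x ∈ D.Neg :=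
  D.neg_of_not_pos hx fun hn => h.not_ge (D.coeff_nonneg hn γ)

lemma pos_of_coeff_nonneg {x : V} (hx : x ∈ D.Φ) (h : ∀ γ, 0 ≤ D.coeff γ x) : x ∈ D.Pos :=
  D.pos_of_not_neg hx fun hn => D.ne_zero_of_mem hx <| D.eq_of_coeff_eq fun γ => by
    rw [map_zero]
    exact le_antisymm (D.coeff_nonpos hn γ) (h γ)

lemma pos_of_simple {γ : V} (hγ : γ ∈ D.Δ) : γ ∈ D.Pos :=
  D.pos_of_coeff_nonneg (D.Δ_sub hγ) fun δ => by
    rw [D.coeff_simple δ ⟨γ, hγ⟩]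
    split <;> norm_num

/-- A positive root other than a simple root `γ` involves a further simple root. -/
lemma exists_coeff_pos {γ x : V} (hγ : γ ∈ D.Δ) (hx : x ∈ D.Pos) (hne : x ≠ γ) :
    ∃ δ : (D.Δ : Set V), (δ : V) ≠ γ ∧ 0 < D.coeff δ x := by
  by_contra! h
  have hx' : x = D.coeff ⟨γ, hγ⟩ x • γ := D.eq_of_coeff_eq fun δ => by
    rw [map_smul, D.coeff_simple δ ⟨γ, hγ⟩, smul_eq_mul]
    split_ifs with hδ
    · rw [hδ, mul_one]
    · rw [mul_zero]
      exact le_antisymm (h δ fun h' => hδ (Subtype.ext h'.symm)) (D.coeff_nonneg hx δ)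
  have h0 := D.coeff_nonneg hx ⟨γ, hγ⟩
  rcases D.reduced γ (D.Δ_sub hγ) _ (hx' ▸ hx.1) with h1 | h1
  · rw [h1, one_smul] at hx'
    exact hne hx'
  · linarith

lemma coeff_sref_of_ne {γ : V} (hγ : γ ∈ D.Δ) (δ : (D.Δ : Set V)) (hδ : (δ : V) ≠ γ) (x : V) :
    D.coeff δ (sref V γ x) = D.coeff δ x := by
  rw [sref_apply, map_sub, map_smul, D.coeff_simple δ ⟨γ, hγ⟩,
    if_neg (fun h => hδ (congrArg Subtype.val h).symm), smul_zero, sub_zero]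

lemma sref_simple_pos {γ x : V} (hγ : γ ∈ D.Δ) (hx : x ∈ D.Pos) (hne : x ≠ γ) :
    sref V γ x ∈ D.Pos := by
  obtain ⟨δ, hδ, h⟩ := D.exists_coeff_pos hγ hx hne
  exact D.pos_of_coeff_pos (D.reflClosed γ (D.Δ_sub hγ) x hx.1)
    (γ := δ) (by rwa [D.coeff_sref_of_ne hγ δ hδ])

/-! ### Words in the simple reflections -/

/-- The product of the reflections in the entries of a list. -/
abbrev word (l : List V) : V ≃ₗ[ℝ] V := (l.map (sref V)).prod

lemma word_inv (l : List V) : (word l)⁻¹ = word l.reverse := by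
  induction l with
  | nil => simp [word]
  | cons a l ih => simp_all [word, sref_inv]

lemma exists_word {w : V ≃ₗ[ℝ] V} (hw : w ∈ D.W) :
    ∃ l : List V, (∀ γ ∈ l, γ ∈ D.Δ) ∧ w = word l := by
  induction hw using Subgroup.closure_induction with
  | mem x hx =>
    obtain ⟨γ, hγ, rfl⟩ := hx
    exact ⟨[γ], by simpa using hγ, by simp [word]⟩
  | one => exact ⟨[], by simp, by simp [word]⟩
  | mul x y _ _ hx hy =>
    obtain ⟨l, hl, rfl⟩ := hx
    obtain ⟨m, hm, rfl⟩ := hy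
    exact ⟨l ++ m, fun γ h => (List.mem_append.mp h).elim (hl γ) (hm γ), by simp [word]⟩
  | inv x _ hx =>
    obtain ⟨l, hl, rfl⟩ := hx
    exact ⟨l.reverse, by simpa using hl, word_inv l⟩

lemma word_mem {l : List V} (hl : ∀ γ ∈ l, γ ∈ D.Δ) : word l ∈ D.W :=
  Subgroup.list_prod_mem _ fun x hx => by
    obtain ⟨γ, hγ, rfl⟩ := List.mem_map.mp hx
    exact Subgroup.subset_closure ⟨γ, hl γ hγ, rfl⟩

lemma word_map_root {l : List V} (hl : ∀ γ ∈ l, γ ∈ D.Δ) {x : V} (hx : x ∈ D.Φ) :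
    word l x ∈ D.Φ := by
  induction l with
  | nil => simpa [word] using hx
  | cons a l ih =>
    have := D.reflClosed a (D.Δ_sub (hl a (by simp))) _ (ih fun γ h => hl γ (by simp [h]))
    simpa [word] using this

lemma map_root {w : V ≃ₗ[ℝ] V} (hw : w ∈ D.W) {x : V} (hx : x ∈ D.Φ) : w x ∈ D.Φ := by
  obtain ⟨l, hl, rfl⟩ := D.exists_word hw
  exact D.word_map_root hl hx

lemma inner_word (l : List V) (x y : V) : ⟪word l x, word l y⟫ = ⟪x, y⟫ := by
  induction l with
  | nil => simp [word]
  | cons a l ih => simpa [word, inner_sref] using ih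

/-- The exchange condition. -/
lemma exchange {l : List V} (hl : ∀ γ ∈ l, γ ∈ D.Δ) {γ : V} (hγ : γ ∈ D.Δ)
    (h : word l γ ∈ D.Neg) :
    ∃ l' : List V, (∀ δ ∈ l', δ ∈ D.Δ) ∧ l'.length + 1 = l.length ∧
      word l * sref V γ = word l' := by
  induction l with
  | nil => exact absurd (by simpa [word] using h) (D.not_neg_of_pos (D.pos_of_simple hγ))
  | cons a l ih =>
    have hl' : ∀ δ ∈ l, δ ∈ D.Δ := fun δ hδ => hl δ (by simp [hδ])
    have ha : a ∈ D.Δ := hl a (by simp)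
    have hw : word (a :: l) = sref V a * word l := by simp [word]
    by_cases hn : word l γ ∈ D.Neg
    · obtain ⟨m, hm, hlen, heq⟩ := ih hl' hn
      refine ⟨a :: m, by simpa [ha] using hm, by simp [hlen], ?_⟩
      rw [hw, mul_assoc, heq]
      simp [word]
    · have hp := D.pos_of_not_neg (D.word_map_root hl' (D.Δ_sub hγ)) hn
      have hγa : word l γ = a := by
        by_contra hne
        rw [hw] at h
        exact D.not_neg_of_pos (D.sref_simple_pos ha hp hne) h
      refine ⟨l, hl', rfl, ?_⟩
      rw [hw, mul_assoc, mul_sref_eq (inner_word l), hγa, ← mul_assoc, sref_mul_self, one_mul]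

lemma length_word_le {l : List V} (hl : ∀ γ ∈ l, γ ∈ D.Δ) : D.length (word l) ≤ l.length :=
  Nat.sInf_le ⟨l, rfl, hl, rfl⟩

lemma exists_reduced_word {w : V ≃ₗ[ℝ] V} (hw : w ∈ D.W) :
    ∃ l : List V, l.length = D.length w ∧ (∀ γ ∈ l, γ ∈ D.Δ) ∧ w = word l := by
  obtain ⟨l, hl, h⟩ := D.exists_word hw
  exact Nat.sInf_mem
    (s := {n | ∃ l : List V, l.length = n ∧ (∀ γ ∈ l, γ ∈ D.Δ) ∧ w = (l.map (sref V)).prod})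
    ⟨l.length, l, rfl, hl, h⟩

lemma length_inv_le {w : V ≃ₗ[ℝ] V} (hw : w ∈ D.W) : D.length w⁻¹ ≤ D.length w := by
  obtain ⟨l, hlen, hl, rfl⟩ := D.exists_reduced_word hw
  rw [← hlen, word_inv, ← List.length_reverse]
  exact D.length_word_le (by simpa using hl)

lemma length_inv {w : V ≃ₗ[ℝ] V} (hw : w ∈ D.W) : D.length w⁻¹ = D.length w :=
  le_antisymm (D.length_inv_le hw) (by simpa using D.length_inv_le (inv_mem hw))

/-! ### Inversions -/

/-- The positive roots sent to negative roots by `u`. -/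
def inversions (u : V ≃ₗ[ℝ] V) : Finset V := D.Φ.filter fun x => x ∈ D.Pos ∧ u x ∈ D.Neg

lemma mem_inversions {u : V ≃ₗ[ℝ] V} {x : V} :
    x ∈ D.inversions u ↔ x ∈ D.Pos ∧ u x ∈ D.Neg := by
  simp only [inversions, Finset.mem_filter, and_iff_right_iff_imp]
  exact fun h => h.1.1

/-- If `u α < 0`, then passing from `u` to `u s_α` loses at least the inversions `γ` of `u` for
which `s_α γ < 0` and `u s_α γ > 0`. -/
lemma card_inversions_mul_sref {u : V ≃ₗ[ℝ] V} (hu : u ∈ D.W) {α : V} (hα : α ∈ D.Pos)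
    (huα : u α ∈ D.Neg) {T : Finset V} (hT : T ⊆ D.inversions u)
    (hT' : ∀ γ ∈ T, sref V α γ ∈ D.Neg ∧ u (sref V α γ) ∈ D.Pos) :
    (D.inversions (u * sref V α)).card + T.card ≤ (D.inversions u).card := by
  let f : V → V := fun x => if sref V α x ∈ D.Pos then sref V α x else x
  have hf : ∀ x ∈ D.inversions (u * sref V α), f x ∈ D.inversions u \ T := by
    intro x hx
    rw [mem_inversions] at hx
    obtain ⟨hxp, hxn⟩ := hx
    have hxn' : u (sref V α x) ∈ D.Neg := hxn
    rw [Finset.mem_sdiff, mem_inversions]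
    by_cases h : sref V α x ∈ D.Pos
    · simp only [f, if_pos h]
      refine ⟨⟨h, hxn⟩, fun hmem => ?_⟩
      have := (hT' _ hmem).1
      rw [sref_sref] at this
      exact D.not_neg_of_pos hxp this
    · simp only [f, if_neg h]
      refine ⟨⟨hxp, ?_⟩, fun hmem => D.not_neg_of_pos (hT' _ hmem).2 hxn⟩
      have hsn := D.neg_of_not_pos (D.reflClosed α hα.1 x hxp.1) h
      obtain ⟨m, hm⟩ : ∃ m, m = 2 * ⟪x, α⟫ / ⟪α, α⟫ := ⟨_, rfl⟩
      have hs : sref V α x = x - m • α := by rw [hm, sref_apply]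
      have hm0 : 0 ≤ m := by
        by_contra! hlt
        refine h (D.pos_of_coeff_nonneg (D.reflClosed α hα.1 x hxp.1) fun γ => ?_)
        rw [hs, map_sub, map_smul, smul_eq_mul]
        nlinarith [D.coeff_nonneg hxp γ, D.coeff_nonneg hα γ]
      have hux : u x = u (sref V α x) + m • u α := by
        rw [hs, map_sub, map_smul]
        abel
      refine D.pos_of_coeff_nonneg (D.neg_mem (D.map_root hu hxp.1)) fun γ => ?_
      rw [hux, map_neg, map_add, map_smul, smul_eq_mul]
      nlinarith [D.coeff_nonpos hxn' γ, D.coeff_nonpos huα γ]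
  have hinj : Set.InjOn f (D.inversions (u * sref V α)) := by
    intro x hx y hy hxy
    rw [Finset.mem_coe, mem_inversions] at hx hy
    by_cases h : sref V α x ∈ D.Pos <;> by_cases h' : sref V α y ∈ D.Pos <;>
      simp only [f, h, h', if_true, if_false] at hxy
    · exact (sref V α).injective hxy
    · refine absurd ?_ h'
      rw [← hxy, sref_sref]
      exact hx.1
    · refine absurd ?_ h
      rw [hxy, sref_sref]
      exact hy.1
    · exact hxy
  have h1 := Finset.card_le_card_of_injOn f hf hinj
  rw [Finset.card_sdiff_of_subset hT] at h1
  have h2 := Finset.card_le_card hT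
  omega

lemma self_mem_inversions {u : V ≃ₗ[ℝ] V} {α : V} (hα : α ∈ D.Pos) (huα : u α ∈ D.Neg) :
    α ∈ D.inversions u ∧ sref V α α ∈ D.Neg ∧ u (sref V α α) ∈ D.Pos := by
  rw [sref_self (D.ne_zero_of_mem hα.1), map_neg, mem_inversions]
  exact ⟨⟨hα, huα⟩, D.neg_neg_of_pos hα, huα⟩

lemma card_inversions_mul_sref_lt {u : V ≃ₗ[ℝ] V} (hu : u ∈ D.W) {α : V} (hα : α ∈ D.Pos)
    (huα : u α ∈ D.Neg) :
    (D.inversions (u * sref V α)).card + 1 ≤ (D.inversions u).card := by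
  obtain ⟨h1, h2⟩ := D.self_mem_inversions hα huα
  simpa using D.card_inversions_mul_sref hu hα huα (T := {α}) (by simpa using h1)
    (by simpa using h2)

lemma card_inversions_mul_simple {u : V ≃ₗ[ℝ] V} (hu : u ∈ D.W) {γ : V} (hγ : γ ∈ D.Δ)
    (huγ : u γ ∈ D.Neg) :
    (D.inversions (u * sref V γ)).card + 1 = (D.inversions u).card := by
  refine le_antisymm (D.card_inversions_mul_sref_lt hu (D.pos_of_simple hγ) huγ) ?_
  have hmem := (D.self_mem_inversions (D.pos_of_simple hγ) huγ).1
  rw [← Finset.card_erase_add_one hmem]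
  refine Nat.add_le_add_right (Finset.card_le_card_of_injOn (sref V γ) (fun x hx => ?_)
    (sref V γ).injective.injOn) 1
  rw [Finset.mem_coe, Finset.mem_erase, mem_inversions] at hx
  rw [Finset.mem_coe, mem_inversions, LinearEquiv.mul_apply, sref_sref]
  exact ⟨D.sref_simple_pos hγ hx.2.1 hx.1, hx.2.2⟩

lemma card_inversions_word (l : List V) (hl : ∀ γ ∈ l, γ ∈ D.Δ)
    (hred : l.length ≤ D.length (word l)) : (D.inversions (word l)).card = l.length := by
  induction l using List.reverseRecOn with
  | nil =>
    rw [List.length_nil, Finset.card_eq_zero, Finset.eq_empty_iff_forall_notMem]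
    intro x hx
    rw [mem_inversions] at hx
    exact D.not_neg_of_pos hx.1 (by simpa [word] using hx.2)
  | append_singleton l γ ih =>
    have hl' : ∀ δ ∈ l, δ ∈ D.Δ := fun δ hδ => hl δ (by simp [hδ])
    have hγ : γ ∈ D.Δ := hl γ (by simp)
    have hw : word (l ++ [γ]) = word l * sref V γ := by simp [word]
    have hw' : word (l ++ [γ]) * sref V γ = word l := by
      rw [hw, mul_assoc, sref_mul_self, mul_one]
    have hneg : word (l ++ [γ]) γ ∈ D.Neg := by
      by_contra hn
      have hn' : word l γ ∈ D.Neg := by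
        have := D.pos_of_not_neg (D.word_map_root hl (D.Δ_sub hγ)) hn
        rwa [hw, LinearEquiv.mul_apply, sref_self (D.ne_zero_of_mem (D.Δ_sub hγ)),
          map_neg] at this
      obtain ⟨m, hm, hlen, heq⟩ := D.exchange hl' hγ hn'
      have := D.length_word_le hm
      rw [← heq, ← hw] at this
      rw [List.length_append, List.length_singleton] at hred
      omega
    have hred' : l.length ≤ D.length (word l) := by
      obtain ⟨m, hlen, hm, heq⟩ := D.exists_reduced_word (D.word_mem hl')
      have := D.length_word_le (l := m ++ [γ])
        (fun δ h => (List.mem_append.mp h).elim (hm δ) fun h => by simp_all)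
      have e : word (m ++ [γ]) = word (l ++ [γ]) := by
        rw [hw, heq]
        simp [word]
      rw [e] at this
      simp only [List.length_append, List.length_singleton] at this hred
      omega
    rw [← D.card_inversions_mul_simple (D.word_mem hl) hγ hneg, hw', ih hl' hred']
    simp

lemma card_inversions {w : V ≃ₗ[ℝ] V} (hw : w ∈ D.W) :
    (D.inversions w).card = D.length w := by
  obtain ⟨l, hlen, hl, rfl⟩ := D.exists_reduced_word hw
  rw [D.card_inversions_word l hl hlen.le, hlen]

lemma length_mul_simple_lt {w : V ≃ₗ[ℝ] V} (hw : w ∈ D.W) {γ : V} (hγ : γ ∈ D.Δ)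
    (h : w γ ∈ D.Neg) : D.length (w * sref V γ) < D.length w := by
  obtain ⟨l, hlen, hl, rfl⟩ := D.exists_reduced_word hw
  obtain ⟨m, hm, hlen', heq⟩ := D.exchange hl hγ h
  have := D.length_word_le hm
  rw [heq]
  omega

/-- If `s_α w` is shorter than `w`, then `w⁻¹ α < 0`. -/
lemma inv_apply_neg_of_length_lt {w : V ≃ₗ[ℝ] V} (hw : w ∈ D.W) {α : V} (hα : α ∈ D.Pos)
    (hsw : sref V α * w ∈ D.W) (hlt : D.length (sref V α * w) < D.length w) :
    w⁻¹ α ∈ D.Neg := by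
  by_contra hn
  have hp := D.pos_of_not_neg (D.map_root (inv_mem hw) hα.1) hn
  have hinv : (sref V α * w)⁻¹ = w⁻¹ * sref V α := by rw [mul_inv_rev, sref_inv]
  have h := D.card_inversions_mul_sref_lt (u := w⁻¹ * sref V α) (hinv ▸ inv_mem hsw) hα
    (by rw [LinearEquiv.mul_apply, sref_self (D.ne_zero_of_mem hα.1), map_neg]
        exact D.neg_neg_of_pos hp)
  rw [mul_assoc, sref_mul_self, mul_one, ← hinv, D.card_inversions (inv_mem hw),
    D.card_inversions (inv_mem hsw), D.length_inv hw, D.length_inv hsw] at h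
  omega

/-- Some simple root pairs positively with a given positive root. -/
lemma exists_simple_inner_pos {α : V} (hα : α ∈ D.Pos) : ∃ γ ∈ D.Δ, 0 < ⟪γ, α⟫ := by
  by_contra! h
  obtain ⟨c, hc⟩ := hα.2
  have h1 : ⟪α, α⟫ = ∑ γ ∈ D.Δ, (c γ : ℝ) * ⟪γ, α⟫ := by
    conv_lhs => rw [hc, sum_inner, ← hc]
    simp only [real_inner_smul_left]
  have h2 : ∑ γ ∈ D.Δ, (c γ : ℝ) * ⟪γ, α⟫ ≤ 0 :=
    Finset.sum_nonpos fun γ hγ => mul_nonpos_of_nonneg_of_nonpos (by positivity) (h γ hγ)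
  have h3 := real_inner_self_pos.mpr (D.ne_zero_of_mem hα.1)
  linarith

end RSD

namespace MRSD

variable {V} (M : MRSD V)

/-- The coefficient of the marked simple root in a vector. -/
def markedCoeff : V →ₗ[ℝ] ℝ := M.coeff ⟨M.αP, M.αP_mem⟩

/-- In the cominuscule case, the marked coefficient of a root is `-1`, `0` or `1`. -/
lemma markedCoeff_cases {x : V} (hx : x ∈ M.Φ) :
    M.markedCoeff x = -1 ∨ M.markedCoeff x = 0 ∨ M.markedCoeff x = 1 := by
  have key : ∀ y ∈ M.Pos, M.markedCoeff y = 0 ∨ M.markedCoeff y = 1 := by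
    rintro y ⟨hy, c, hc⟩
    obtain ⟨d, hd⟩ := M.θ_high y hy
    obtain ⟨e, he, he1⟩ := M.θ_coeff
    have h1 : M.markedCoeff y = c M.αP := by
      conv_lhs => rw [hc]
      exact M.coeff_sum _ c
    have h2 : M.markedCoeff (M.θ - y) = d M.αP := by rw [hd]; exact M.coeff_sum _ d
    have h3 : M.markedCoeff M.θ = e M.αP := by
      conv_lhs => rw [he]
      exact M.coeff_sum _ e
    rw [map_sub, h1, h3, he1] at h2
    have h4 : c M.αP + d M.αP = 1 := by
      have : (c M.αP : ℝ) + d M.αP = 1 := by push_cast at h2; linarith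
      exact_mod_cast this
    rw [h1]
    have : c M.αP = 0 ∨ c M.αP = 1 := by omega
    exact_mod_cast this
  rcases M.pos_or_neg hx with h | h
  · exact Or.inr (key x h)
  · have := key _ h
    rw [map_neg] at this
    rcases this with h | h
    · exact Or.inr (Or.inl (by linarith))
    · exact Or.inl (by linarith)

/-- A minimal coset representative sends the positive roots of `Φ_P` to positive roots. -/
lemma IsMinRep.pos {M : MRSD V} {v : V ≃ₗ[ℝ] V} (hv : M.IsMinRep v) {x : V} (hx : x ∈ M.Pos)
    (h0 : M.markedCoeff x = 0) : v x ∈ M.Pos := by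
  have hsimple : ∀ γ ∈ M.Δ, γ ≠ M.αP → v γ ∈ M.Pos := by
    intro γ hγ hne
    refine M.pos_of_not_neg (M.map_root hv.1 (M.Δ_sub hγ)) fun hn => ?_
    have hsW : sref V γ ∈ M.W := Subgroup.subset_closure ⟨γ, hγ, rfl⟩
    have := hv.2 (v * sref V γ) (mul_mem hv.1 hsW) (by
      rw [inv_mul_cancel_left]
      exact Subgroup.subset_closure ⟨γ, by simp [hγ, hne], rfl⟩)
    exact absurd (M.length_mul_simple_lt hv.1 hγ hn) this.not_gt
  obtain ⟨c, hc⟩ := hx.2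
  have hcP : c M.αP = 0 := by
    have : M.markedCoeff x = c M.αP := by
      conv_lhs => rw [hc]
      exact M.coeff_sum _ c
    exact_mod_cast this.symm.trans h0
  refine M.pos_of_coeff_nonneg (M.map_root hv.1 hx.1) fun δ => ?_
  rw [hc, map_sum, map_sum]
  refine Finset.sum_nonneg fun γ hγ => ?_
  rw [map_smul, map_smul, smul_eq_mul]
  by_cases h : γ = M.αP
  · simp [h, hcP]
  · exact mul_nonneg (by positivity) (M.coeff_nonneg (hsimple γ hγ h) δ)

lemma IsMinRep.neg {M : MRSD V} {v : V ≃ₗ[ℝ] V} (hv : M.IsMinRep v) {x : V} (hx : x ∈ M.Neg)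
    (h0 : M.markedCoeff x = 0) : v x ∈ M.Neg := by
  have := hv.pos (x := -x) hx (by rw [map_neg, h0, neg_zero])
  rwa [map_neg] at this

end MRSD

/-- Let `v ∈ W^P` and let `α ∈ Φ⁺` be such that `s_α v ∈ W^P` and
`ℓ(s_α v) = ℓ(v) - 1`. Then `α` is a simple root. -/
theorem statement0 {V : Type} [NormedAddCommGroup V] [InnerProductSpace ℝ V]
    [FiniteDimensional ℝ V]
    (M : MRSD V) (v : V ≃ₗ[ℝ] V) (α : V)
    (hv : M.IsMinRep v) (hα : α ∈ M.Pos)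
    (hsv : M.IsMinRep (sref V α * v))
    (hlen : M.length (sref V α * v) + 1 = M.length v) :
    α ∈ M.Δ := by
  by_contra hαΔ
  obtain ⟨γ, hγ, hγα⟩ := M.exists_simple_inner_pos hα
  have hne : α ≠ γ := fun h => hαΔ (h ▸ hγ)
  have hγp := M.pos_of_simple hγ
  obtain ⟨k, hk⟩ := M.crystal α hα.1 γ (M.Δ_sub hγ)
  have hs : sref V α γ = γ - (k : ℝ) • α := by rw [hk, sref_apply]
  have hk1 : (1 : ℝ) ≤ k := by
    have : (0 : ℝ) < k := by
      rw [hk]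
      have := real_inner_self_pos.mpr (M.ne_zero_of_mem hα.1)
      positivity
    exact_mod_cast this
  have hsΦ : sref V α γ ∈ M.Φ := M.reflClosed α hα.1 γ (M.Δ_sub hγ)
  have hsneg : sref V α γ ∈ M.Neg := by
    obtain ⟨δ, hδ, hpos⟩ := M.exists_coeff_pos hγ hα hne
    refine M.neg_of_coeff_neg hsΦ (γ := δ) ?_
    rw [hs, map_sub, map_smul, smul_eq_mul, M.coeff_simple δ ⟨γ, hγ⟩,
      if_neg (fun h => hδ (congrArg Subtype.val h).symm)]
    nlinarith
  set u := v⁻¹ with hu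
  have huW : u ∈ M.W := inv_mem hv.1
  have hvu : ∀ x, v (u x) = x := fun x => by rw [hu, ← LinearEquiv.mul_apply]; simp
  have hαneg : u α ∈ M.Neg := M.inv_apply_neg_of_length_lt hv.1 hα hsv.1 (by omega)
  have hcα : M.markedCoeff (u α) = -1 := by
    rcases M.markedCoeff_cases (M.map_root huW hα.1) with h | h | h
    · exact h
    · have := hv.neg hαneg h
      rw [hvu] at this
      exact absurd this (M.not_neg_of_pos hα)
    · have : M.markedCoeff (u α) ≤ 0 := M.coeff_nonpos hαneg _
      linarith
  have hcs : M.markedCoeff (u (sref V α γ)) = M.markedCoeff (u γ) + k := by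
    rw [hs, map_sub, map_smul, map_sub, map_smul, hcα, smul_eq_mul]
    ring
  have huγΦ := M.map_root huW (M.Δ_sub hγ)
  have husΦ := M.map_root huW hsΦ
  have hγneg : M.markedCoeff (u γ) = -1 := by
    rcases M.markedCoeff_cases huγΦ with h | h | h
    · exact h
    · exfalso
      have hp : u γ ∈ M.Pos := M.pos_of_not_neg huγΦ fun hn => by
        have := hv.neg hn h
        rw [hvu] at this
        exact M.not_neg_of_pos hγp this
      have := hsv.pos hp h
      rw [LinearEquiv.mul_apply, hvu] at this
      exact M.not_neg_of_pos this hsneg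
    · rcases M.markedCoeff_cases husΦ with h' | h' | h' <;> linarith
  have huγ : u γ ∈ M.Neg := M.neg_of_coeff_neg huγΦ
    (γ := ⟨M.αP, M.αP_mem⟩) (by change M.markedCoeff (u γ) < 0; linarith)
  have huspos : u (sref V α γ) ∈ M.Pos := by
    refine M.pos_of_not_neg husΦ fun hn => ?_
    have hle : M.markedCoeff (u (sref V α γ)) ≤ 0 := M.coeff_nonpos hn _
    have := hsv.neg hn (by linarith)
    rw [LinearEquiv.mul_apply, hvu, RSD.sref_sref] at this
    exact M.not_neg_of_pos hγp this
  obtain ⟨h1, h2⟩ := M.self_mem_inversions hα hαneg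
  have hcard := M.card_inversions_mul_sref huW hα hαneg (T := {α, γ})
    (by
      intro x hx
      rcases Finset.mem_insert.mp hx with rfl | hx
      · exact h1
      · rw [Finset.mem_singleton.mp hx, M.mem_inversions]
        exact ⟨hγp, huγ⟩)
    (by
      intro x hx
      rcases Finset.mem_insert.mp hx with rfl | hx
      · exact h2
      · rw [Finset.mem_singleton.mp hx]
        exact ⟨hsneg, huspos⟩)
  have hinv : u * sref V α = (sref V α * v)⁻¹ := by rw [mul_inv_rev, RSD.sref_inv]
  rw [Finset.card_pair hne, hinv, M.card_inversions (inv_mem hsv.1), M.card_inversions huW,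
    M.length_inv hsv.1, hu, M.length_inv hv.1] at hcard
  omega
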